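/- (One-step contraction of the two-node Gibbs sampler.) Let d ≥ 1, η > 0, let f : ℝ^d → ℝ be α_f-strongly convex and g : ℝ^d → ℝ be α_g-strongly convex (α_f, α_g > 0), and let π^{XY} be the probability measure on ℝ^d × ℝ^d with density proportional to exp(−f(x) − g(y) − ‖x−y‖²/(2η)), with X-marginal π^X and Y-marginal π^Y. For x ∈ ℝ^d let π^{Y|X=x} be the probability density on ℝ^d proportional to y ↦ exp(−g(y) − ‖x−y‖²/(2η)). For a probability measure μ^X on ℝ^d with D_KL(μ^X ‖ π^X) < ∞, define μ^Y as the probability measure with density y ↦ ∫ π^{Y|X=x}(y) dμ^X(x). Then D_KL(μ^Y ‖ π^Y) ≤ D_KL(μ^X ‖ π^X) / ((1 + η α_f)(1 + η α_g)). -/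

import Mathlib

open MeasureTheory Real
open scoped ENNReal Classical

noncomputable section

/-- Kullback–Leibler divergence `D_KL(μ ‖ ν) = ∫ log(dμ/dν) dμ` (valued in `[0,∞]`,
with the convention that it is `∞` when `μ` is not absolutely continuous w.r.t. `ν`;
for `μ ≪ ν` it is computed via the nonnegative integrand `f log f − f + 1`,
`f = dμ/dν`, integrated against `ν`). -/
def klDiv {X : Type*} [MeasurableSpace X] (μ ν : Measure X) : ℝ≥0∞ :=
  if μ ≪ ν then
    ∫⁻ x, ENNReal.ofReal ((μ.rnDeriv ν x).toReal * Real.log ((μ.rnDeriv ν x).toReal)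
      - (μ.rnDeriv ν x).toReal + 1) ∂ν
  else ⊤

variable (d : ℕ) (η : ℝ)

/-- Unnormalized density `exp(−f(x) − g(y) − ‖x−y‖²/(2η))` of the two-node target. -/
def jointDens (f g : EuclideanSpace ℝ (Fin d) → ℝ)
    (p : EuclideanSpace ℝ (Fin d) × EuclideanSpace ℝ (Fin d)) : ℝ :=
  Real.exp (-f p.1 - g p.2 - ‖p.1 - p.2‖ ^ 2 / (2 * η))

/-- The two-node target measure `π^{XY} ∝ exp(−f(x) − g(y) − ‖x−y‖²/(2η))`. -/
def targetXY (f g : EuclideanSpace ℝ (Fin d) → ℝ) :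
    Measure (EuclideanSpace ℝ (Fin d) × EuclideanSpace ℝ (Fin d)) :=
  volume.withDensity fun p =>
    ENNReal.ofReal (jointDens d η f g p / ∫ q, jointDens d η f g q)

/-- The `X`-marginal `π^X` of the two-node target. -/
def targetX (f g : EuclideanSpace ℝ (Fin d) → ℝ) :
    Measure (EuclideanSpace ℝ (Fin d)) :=
  (targetXY d η f g).map Prod.fst

/-- The `Y`-marginal `π^Y` of the two-node target. -/
def targetY (f g : EuclideanSpace ℝ (Fin d) → ℝ) :
    Measure (EuclideanSpace ℝ (Fin d)) :=
  (targetXY d η f g).map Prod.snd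

/-- The conditional density `π^{Y|X=x}(y) ∝ exp(−g(y) − ‖x−y‖²/(2η))`. -/
def condYgivenX (g : EuclideanSpace ℝ (Fin d) → ℝ)
    (x y : EuclideanSpace ℝ (Fin d)) : ℝ :=
  Real.exp (-g y - ‖x - y‖ ^ 2 / (2 * η)) /
    ∫ y', Real.exp (-g y' - ‖x - y'‖ ^ 2 / (2 * η))


open scoped Pointwise in
/-- One-dimensional Brunn–Minkowski inequality for compact sets. -/
lemma volume_add_volume_le_of_isCompact {A B C : Set ℝ} {a b : ℝ} (ha : 0 < a) (hb : 0 < b)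
    (hA : IsCompact A) (hB : IsCompact B) (hAne : A.Nonempty) (hBne : B.Nonempty)
    (hC : ∀ x ∈ A, ∀ y ∈ B, a * x + b * y ∈ C) :
    ENNReal.ofReal a * volume A + ENNReal.ofReal b * volume B ≤ volume C := by
  have hsA := hA.sSup_mem hAne
  have hiB := hB.sInf_mem hBne
  set p := sSup A
  set q := sInf B
  have hcK : IsCompact ((fun x => a * x + b * q) '' A) := hA.image (by fun_prop)
  have hcL : IsCompact ((fun y => a * p + b * y) '' B) := hB.image (by fun_prop)
  have hvol : ∀ (r t : ℝ), 0 < r → ∀ S : Set ℝ,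
      volume ((fun x => r * x + t) '' S) = ENNReal.ofReal r * volume S := by
    intro r t hr S
    have : (fun x => r * x + t) '' S = (fun x => x + t) '' (r • S) := by
      ext z; simp [Set.mem_smul_set, eq_add_neg_iff_add_eq]
    rw [this]
    simp [Measure.addHaar_smul, abs_of_pos hr]
  have hdisj : AEDisjoint volume ((fun x => a * x + b * q) '' A)
      ((fun y => a * p + b * y) '' B) := by
    refine measure_mono_null (t := {a * p + b * q}) ?_ (by simp)
    rintro z ⟨⟨x, hx, rfl⟩, ⟨y, hy, hxy⟩⟩
    have h1 : x ≤ p := le_csSup hA.bddAbove hx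
    have h2 : q ≤ y := csInf_le hB.bddBelow hy
    simp only at hxy
    have h3 := mul_le_mul_of_nonneg_left h1 ha.le
    have h4 := mul_le_mul_of_nonneg_left h2 hb.le
    simp only [Set.mem_singleton_iff]
    linarith
  calc _ = volume ((fun x => a * x + b * q) '' A) + volume ((fun y => a * p + b * y) '' B) := by
        rw [hvol a _ ha, ← hvol b (a * p) hb]
        simp only [add_comm]
    _ = volume ((fun x => a * x + b * q) '' A ∪ (fun y => a * p + b * y) '' B) :=
        (measure_union₀ hcL.measurableSet.nullMeasurableSet hdisj).symm
    _ ≤ volume C := by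
        apply measure_mono
        rintro z (⟨x, hx, rfl⟩ | ⟨y, hy, rfl⟩)
        · exact hC x hx q hiB
        · exact hC p hsA y hy

/-- One-dimensional Brunn–Minkowski inequality. -/
lemma volume_add_volume_le {A B C : Set ℝ} {a b : ℝ} (ha : 0 < a) (hb : 0 < b)
    (hA : MeasurableSet A) (hB : MeasurableSet B) (hAne : A.Nonempty) (hBne : B.Nonempty)
    (hC : ∀ x ∈ A, ∀ y ∈ B, a * x + b * y ∈ C) :
    ENNReal.ofReal a * volume A + ENNReal.ofReal b * volume B ≤ volume C := by
  obtain ⟨x₀, hx₀⟩ := hAne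
  obtain ⟨y₀, hy₀⟩ := hBne
  have key : ∀ K ⊆ A, IsCompact K → ∀ L ⊆ B, IsCompact L →
      ENNReal.ofReal a * volume K + ENNReal.ofReal b * volume L ≤ volume C := by
    intro K hK hKc L hL hLc
    refine le_trans ?_ (volume_add_volume_le_of_isCompact (C := C) ha hb (hKc.insert x₀)
      (hLc.insert y₀)
      (Set.insert_nonempty _ _) (Set.insert_nonempty _ _) ?_)
    · gcongr <;> exact Set.subset_insert _ _
    · intro x hx y hy
      exact hC x (Set.insert_subset hx₀ hK hx) y (Set.insert_subset hy₀ hL hy)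
  rw [hA.measure_eq_iSup_isCompact, hB.measure_eq_iSup_isCompact]
  simp only [ENNReal.mul_iSup]
  simp only [iSup_and']
  exact ENNReal.biSup_add_biSup_le' ⟨∅, Set.empty_subset _, isCompact_empty⟩
    ⟨∅, Set.empty_subset _, isCompact_empty⟩ fun K hK L hL => key K hK.1 hK.2 L hL.1 hL.2

lemma ENNReal.geom_mean_le_arith_mean_of_add_eq_one {a b : ℝ} (ha : 0 < a) (hb : 0 < b)
    (hab : a + b = 1) (x y : ℝ≥0∞) :
    x ^ a * y ^ b ≤ ENNReal.ofReal a * x + ENNReal.ofReal b * y := by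
  induction x with
  | top => simp [ENNReal.mul_top, ha]
  | coe x =>
  induction y with
  | top => simp [ENNReal.mul_top, hb]
  | coe y =>
  have := NNReal.geom_mean_le_arith_mean2_weighted ⟨a, ha.le⟩ ⟨b, hb.le⟩ x y (by
    ext; exact hab)
  rw [← ENNReal.coe_rpow_of_nonneg _ ha.le, ← ENNReal.coe_rpow_of_nonneg _ hb.le,
    ENNReal.ofReal_eq_coe_nnreal ha.le, ENNReal.ofReal_eq_coe_nnreal hb.le]
  exact_mod_cast this

/-- Prékopa–Leindler on the line, for functions with supremum `1`. -/
lemma prekopa_leindler_real_of_sup_one {F G H : ℝ → ℝ} {a b : ℝ} (ha : 0 < a) (hb : 0 < b)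
    (hab : a + b = 1) (hF : Measurable F) (hG : Measurable G) (hH : Measurable H)
    (hF0 : ∀ x, 0 ≤ F x) (hG0 : ∀ x, 0 ≤ G x) (hH0 : ∀ x, 0 ≤ H x)
    (hF1 : ∀ x, F x ≤ 1) (hG1 : ∀ x, G x ≤ 1)
    (hFs : ∀ t < 1, ∃ x, t < F x) (hGs : ∀ t < 1, ∃ x, t < G x)
    (h : ∀ x y, F x ^ a * G y ^ b ≤ H (a * x + b * y)) :
    (∫⁻ x, ENNReal.ofReal (F x)) ^ a * (∫⁻ x, ENNReal.ofReal (G x)) ^ b ≤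
      ∫⁻ x, ENNReal.ofReal (H x) := by
  refine (ENNReal.geom_mean_le_arith_mean_of_add_eq_one ha hb hab _ _).trans ?_
  rw [lintegral_eq_lintegral_meas_lt _ (ae_of_all _ hF0) hF.aemeasurable,
    lintegral_eq_lintegral_meas_lt _ (ae_of_all _ hG0) hG.aemeasurable,
    lintegral_eq_lintegral_meas_lt _ (ae_of_all _ hH0) hH.aemeasurable]
  have hm : ∀ K : ℝ → ℝ, Measurable fun t => volume {x | t < K x} := fun K =>
    Antitone.measurable fun s t hst => measure_mono fun x (hx : t < K x) => lt_of_le_of_lt hst hx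
  rw [← lintegral_const_mul _ (hm F), ← lintegral_const_mul _ (hm G),
    ← lintegral_add_left ((hm F).const_mul _)]
  refine setLIntegral_mono (hm H) fun t ht => ?_
  have ht0 : 0 < t := ht
  rcases lt_or_ge t 1 with ht1 | ht1
  · refine volume_add_volume_le ha hb (measurableSet_lt measurable_const hF)
      (measurableSet_lt measurable_const hG) (hFs t ht1) (hGs t ht1) ?_
    intro x hx y hy
    refine lt_of_lt_of_le ?_ (h x y)
    calc t = t ^ a * t ^ b := by rw [← Real.rpow_add ht0, hab, Real.rpow_one]
      _ < F x ^ a * G y ^ b := by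
        have h1 := Real.rpow_lt_rpow ht0.le hx ha
        have h2 := Real.rpow_lt_rpow ht0.le hy hb
        exact mul_lt_mul'' h1 h2 (by positivity) (by positivity)
  · have e1 : {x | t < F x} = ∅ := by
      ext x; simpa using (hF1 x).trans ht1
    have e2 : {x | t < G x} = ∅ := by
      ext x; simpa using (hG1 x).trans ht1
    simp [e1, e2]

/-- Prékopa–Leindler on the line, for bounded functions. -/
lemma prekopa_leindler_real_of_bdd {F G H : ℝ → ℝ} {a b : ℝ} (ha : 0 < a) (hb : 0 < b)
    (hab : a + b = 1) (hF : Measurable F) (hG : Measurable G) (hH : Measurable H)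
    (hF0 : ∀ x, 0 ≤ F x) (hG0 : ∀ x, 0 ≤ G x) (hH0 : ∀ x, 0 ≤ H x)
    (hFb : BddAbove (Set.range F)) (hGb : BddAbove (Set.range G))
    (h : ∀ x y, F x ^ a * G y ^ b ≤ H (a * x + b * y)) :
    (∫⁻ x, ENNReal.ofReal (F x)) ^ a * (∫⁻ x, ENNReal.ofReal (G x)) ^ b ≤
      ∫⁻ x, ENNReal.ofReal (H x) := by
  have hFle : ∀ x, F x ≤ sSup (Set.range F) := fun x => le_csSup hFb ⟨x, rfl⟩
  have hGle : ∀ x, G x ≤ sSup (Set.range G) := fun x => le_csSup hGb ⟨x, rfl⟩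
  have hlt : ∀ K : ℝ → ℝ, 0 < sSup (Set.range K) → ∀ t < 1, ∃ x, t < K x / sSup (Set.range K) := by
    intro K hK t ht
    obtain ⟨_, ⟨x, rfl⟩, hx⟩ := exists_lt_of_lt_csSup (Set.range_nonempty K)
      (show t * sSup (Set.range K) < sSup (Set.range K) by nlinarith)
    exact ⟨x, (lt_div_iff₀ hK).2 hx⟩
  have hFs0 : 0 ≤ sSup (Set.range F) := (hF0 0).trans (hFle 0)
  have hGs0 : 0 ≤ sSup (Set.range G) := (hG0 0).trans (hGle 0)
  rcases hFs0.eq_or_lt with h0 | hp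
  · have : ∀ x, F x = 0 := fun x => le_antisymm ((hFle x).trans h0.ge) (hF0 x)
    simp [this, ENNReal.zero_rpow_of_pos ha]
  rcases hGs0.eq_or_lt with h0 | hq
  · have : ∀ x, G x = 0 := fun x => le_antisymm ((hGle x).trans h0.ge) (hG0 x)
    simp [this, ENNReal.zero_rpow_of_pos hb]
  have hFs := hlt F hp
  have hGs := hlt G hq
  set p := sSup (Set.range F)
  set q := sSup (Set.range G)
  have hpq : 0 < p ^ a * q ^ b := by positivity
  have := prekopa_leindler_real_of_sup_one (F := fun x => F x / p) (G := fun x => G x / q)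
    (H := fun x => H x / (p ^ a * q ^ b)) ha hb hab (hF.div_const _) (hG.div_const _)
    (hH.div_const _) (fun x => div_nonneg (hF0 x) hp.le) (fun x => div_nonneg (hG0 x) hq.le)
    (fun x => div_nonneg (hH0 x) hpq.le) (fun x => (div_le_one hp).2 (hFle x))
    (fun x => (div_le_one hq).2 (hGle x)) hFs hGs (fun x y => by
      rw [Real.div_rpow (hF0 x) hp.le, Real.div_rpow (hG0 y) hq.le, div_mul_div_comm]
      exact div_le_div_of_nonneg_right (h x y) hpq.le)
  have scale : ∀ (K : ℝ → ℝ) (c : ℝ), Measurable K → 0 < c → ∫⁻ x, ENNReal.ofReal (K x) =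
      ENNReal.ofReal c * ∫⁻ x, ENNReal.ofReal (K x / c) := by
    intro K c hK hc
    rw [← lintegral_const_mul _ (by fun_prop)]
    congr 1 with x
    rw [← ENNReal.ofReal_mul hc.le, mul_div_cancel₀ _ hc.ne']
  rw [scale F p hF hp, scale G q hG hq, scale H _ hH hpq, ENNReal.mul_rpow_of_nonneg _ _ ha.le,
    ENNReal.mul_rpow_of_nonneg _ _ hb.le, ENNReal.ofReal_rpow_of_pos hp,
    ENNReal.ofReal_rpow_of_pos hq, mul_mul_mul_comm, ← ENNReal.ofReal_mul (by positivity)]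
  gcongr

/-- Prékopa–Leindler on the line. -/
lemma prekopa_leindler_real {F G H : ℝ → ℝ≥0∞} {a b : ℝ} (ha : 0 < a) (hb : 0 < b)
    (hab : a + b = 1) (hF : Measurable F) (hG : Measurable G) (hH : Measurable H)
    (h : ∀ x y, F x ^ a * G y ^ b ≤ H (a * x + b * y)) :
    (∫⁻ x, F x) ^ a * (∫⁻ x, G x) ^ b ≤ ∫⁻ x, H x := by
  have trunc : ∀ n : ℕ, (∫⁻ x, min (F x) n) ^ a * (∫⁻ x, min (G x) n) ^ b ≤ ∫⁻ x, H x := by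
    intro n
    have hfin : ∀ (K : ℝ → ℝ≥0∞) (x), min (K x) n ≠ ∞ := fun K x =>
      ((min_le_right _ _).trans_lt (ENNReal.natCast_lt_top n)).ne
    have hle : ∀ (K : ℝ → ℝ≥0∞), BddAbove (Set.range fun x => (min (K x) n).toReal) := by
      intro K
      refine ⟨n, ?_⟩
      rintro _ ⟨x, rfl⟩
      exact ENNReal.toReal_le_of_le_ofReal (by positivity) (by simp)
    have := prekopa_leindler_real_of_bdd (F := fun x => (min (F x) n).toReal)
      (G := fun x => (min (G x) n).toReal) (H := fun x => (min (H x) n).toReal) ha hb hab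
      (by fun_prop) (by fun_prop) (by fun_prop) (fun _ => ENNReal.toReal_nonneg)
      (fun _ => ENNReal.toReal_nonneg) (fun _ => ENNReal.toReal_nonneg) (hle F) (hle G) (by
        intro x y
        rw [ENNReal.toReal_rpow, ENNReal.toReal_rpow, ← ENNReal.toReal_mul]
        refine ENNReal.toReal_mono (hfin H _) (le_min ?_ ?_)
        · refine le_trans ?_ (h x y)
          gcongr <;> exact min_le_left _ _
        · calc (min (F x) n) ^ a * (min (G y) n) ^ b ≤ (n : ℝ≥0∞) ^ a * (n : ℝ≥0∞) ^ b := by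
                gcongr <;> exact min_le_right _ _
            _ = n := by
                rw [← ENNReal.rpow_add_of_nonneg _ _ ha.le hb.le, hab, ENNReal.rpow_one])
    simp only [ENNReal.ofReal_toReal (hfin _ _)] at this
    exact this.trans (lintegral_mono fun x => min_le_left _ _)
  have lim : ∀ K : ℝ → ℝ≥0∞, Measurable K →
      Filter.Tendsto (fun n : ℕ => ∫⁻ x, min (K x) n) Filter.atTop (nhds (∫⁻ x, K x)) := by
    intro K hK
    refine lintegral_tendsto_of_tendsto_of_monotone (fun n => by fun_prop)
      (ae_of_all _ fun x m n hmn => ?_) (ae_of_all _ fun x => ?_)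
    · exact min_le_min_left _ (by exact_mod_cast hmn)
    · simpa using (tendsto_const_nhds (x := K x)).min ENNReal.tendsto_nat_nhds_top
  by_cases hF0 : ∫⁻ x, F x = 0
  · simp [hF0, ENNReal.zero_rpow_of_pos ha]
  by_cases hG0 : ∫⁻ x, G x = 0
  · simp [hG0, ENNReal.zero_rpow_of_pos hb]
  refine le_of_tendsto (ENNReal.Tendsto.mul ((lim F hF).ennrpow_const a) (Or.inl ?_)
    ((lim G hG).ennrpow_const b) (Or.inl ?_)) (Filter.Eventually.of_forall trunc)
  · simp [ENNReal.rpow_eq_zero_iff, hF0, not_lt.2 ha.le]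
  · simp [ENNReal.rpow_eq_zero_iff, hG0, not_lt.2 hb.le]

/-- Prékopa–Leindler inequality on `ℝⁿ`. -/
lemma prekopa_leindler_pi {n : ℕ} {F G H : (Fin n → ℝ) → ℝ≥0∞} {a b : ℝ} (ha : 0 < a) (hb : 0 < b)
    (hab : a + b = 1) (hF : Measurable F) (hG : Measurable G) (hH : Measurable H)
    (h : ∀ x y, F x ^ a * G y ^ b ≤ H (a • x + b • y)) :
    (∫⁻ x, F x) ^ a * (∫⁻ x, G x) ^ b ≤ ∫⁻ x, H x := by
  induction n with
  | zero =>
    rw [Measure.volume_pi_eq_dirac]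
    simp only [lintegral_dirac]
    convert! h _ _
  | succ n ih =>
    have e : ∀ K : (Fin (n + 1) → ℝ) → ℝ≥0∞, Measurable K →
        ∫⁻ x, K x = ∫⁻ t : ℝ, ∫⁻ z : Fin n → ℝ, K (Fin.insertNth 0 t z) := by
      intro K hK
      rw [(volume_preserving_piFinSuccAbove (fun _ : Fin (n + 1) => ℝ) 0).symm.lintegral_map_equiv,
        Measure.volume_eq_prod, lintegral_prod]
      · rfl
      · exact (hK.comp (MeasurableEquiv.measurable _)).aemeasurable
    have hmeas : ∀ K : (Fin (n + 1) → ℝ) → ℝ≥0∞, Measurable K →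
        Measurable fun p : ℝ × (Fin n → ℝ) => K (Fin.insertNth 0 p.1 p.2) := fun K hK =>
      hK.comp (MeasurableEquiv.piFinSuccAbove (fun _ : Fin (n + 1) => ℝ) 0).symm.measurable
    rw [e F hF, e G hG, e H hH]
    refine prekopa_leindler_real ha hb hab (hmeas F hF).lintegral_prod_right'
      (hmeas G hG).lintegral_prod_right' (hmeas H hH).lintegral_prod_right' fun s t => ?_
    refine ih ((hmeas F hF).comp measurable_prodMk_left)
      ((hmeas G hG).comp measurable_prodMk_left) ((hmeas H hH).comp measurable_prodMk_left)
      fun x y => ?_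
    refine (h _ _).trans (le_of_eq ?_)
    congr 1
    ext i
    refine Fin.cases ?_ (fun j => ?_) i <;> simp

/-- Prékopa–Leindler inequality on Euclidean space. -/
lemma prekopa_leindler {n : ℕ} {F G H : EuclideanSpace ℝ (Fin n) → ℝ≥0∞} {a b : ℝ}
    (ha : 0 < a) (hb : 0 < b) (hab : a + b = 1)
    (hF : Measurable F) (hG : Measurable G) (hH : Measurable H)
    (h : ∀ x y, F x ^ a * G y ^ b ≤ H (a • x + b • y)) :
    (∫⁻ x, F x) ^ a * (∫⁻ x, G x) ^ b ≤ ∫⁻ x, H x := by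
  have e : ∀ K : EuclideanSpace ℝ (Fin n) → ℝ≥0∞,
      ∫⁻ x, K x = ∫⁻ x, K ((MeasurableEquiv.toLp 2 (Fin n → ℝ)) x) := fun K =>
    MeasurePreserving.lintegral_map_equiv _ _
      (EuclideanSpace.volume_preserving_symm_measurableEquiv_toLp (Fin n)).symm
  rw [e F, e G, e H]
  refine prekopa_leindler_pi ha hb hab (by fun_prop) (by fun_prop) (by fun_prop) fun x y => ?_
  exact h _ _

/-- Prékopa–Leindler inequality for Bochner integrals of nonnegative functions. -/
lemma prekopa_leindler_integral {n : ℕ} {F G H : EuclideanSpace ℝ (Fin n) → ℝ} {a b : ℝ}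
    (ha : 0 < a) (hb : 0 < b) (hab : a + b = 1)
    (hF : Measurable F) (hG : Measurable G) (hH : Measurable H)
    (hF0 : ∀ x, 0 ≤ F x) (hG0 : ∀ x, 0 ≤ G x) (hH0 : ∀ x, 0 ≤ H x)
    (hFi : Integrable F) (hGi : Integrable G) (hHi : Integrable H)
    (h : ∀ x y, F x ^ a * G y ^ b ≤ H (a • x + b • y)) :
    (∫ x, F x) ^ a * (∫ x, G x) ^ b ≤ ∫ x, H x := by
  have := prekopa_leindler (F := fun x => ENNReal.ofReal (F x))
    (G := fun x => ENNReal.ofReal (G x)) (H := fun x => ENNReal.ofReal (H x)) ha hb hab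
    (by fun_prop) (by fun_prop) (by fun_prop) (fun x y => by
      rw [ENNReal.ofReal_rpow_of_nonneg (hF0 x) ha.le, ENNReal.ofReal_rpow_of_nonneg (hG0 y) hb.le,
        ← ENNReal.ofReal_mul (Real.rpow_nonneg (hF0 x) _)]
      exact ENNReal.ofReal_le_ofReal (h x y))
  rw [← ofReal_integral_eq_lintegral_ofReal hFi (ae_of_all _ hF0),
    ← ofReal_integral_eq_lintegral_ofReal hGi (ae_of_all _ hG0),
    ← ofReal_integral_eq_lintegral_ofReal hHi (ae_of_all _ hH0),
    ENNReal.ofReal_rpow_of_nonneg (integral_nonneg hF0) ha.le,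
    ENNReal.ofReal_rpow_of_nonneg (integral_nonneg hG0) hb.le,
    ← ENNReal.ofReal_mul (Real.rpow_nonneg (integral_nonneg hF0) _)] at this
  exact (ENNReal.ofReal_le_ofReal_iff (integral_nonneg hH0)).1 this

lemma StrongConvexOn.continuous_of_univ {n : ℕ} {f : EuclideanSpace ℝ (Fin n) → ℝ} {α : ℝ}
    (hα : 0 < α) (hf : StrongConvexOn Set.univ α f) : Continuous f := by
  have hc : ConvexOn ℝ Set.univ f := UniformConvexOn.convexOn hf fun r => by
    simp only [Pi.zero_apply]; positivity
  exact hc.locallyLipschitz.continuous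

lemma StrongConvexOn.exists_quadratic_le {n : ℕ} {f : EuclideanSpace ℝ (Fin n) → ℝ} {α : ℝ}
    (hα : 0 < α) (hf : StrongConvexOn Set.univ α f) : ∃ C, ∀ x, α / 4 * ‖x‖ ^ 2 - C ≤ f x := by
  obtain ⟨δ, hδ, hball⟩ := Metric.continuousAt_iff.1
    ((hf.continuous_of_univ hα).continuousAt (x := (0 : EuclideanSpace ℝ (Fin n)))) 1 one_pos
  set ε := δ / 2 with hε
  have hε0 : 0 < ε := by positivity
  have hnear : ∀ x, ‖x‖ ≤ ε → f 0 - 1 ≤ f x := by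
    intro x hx
    have := hball (x := x) (by rw [dist_zero_right]; linarith)
    rw [Real.dist_eq, abs_lt] at this
    linarith
  set k := 1 / ε + α / 2 * ε with hk
  refine ⟨|f 0| + 1 + α / 4 * ε ^ 2 + k ^ 2 / α, fun x => ?_⟩
  have h0 := neg_abs_le (f 0)
  rcases le_or_gt ‖x‖ ε with hx | hx
  · have h1 := hnear x hx
    have h2 : ‖x‖ ^ 2 ≤ ε ^ 2 := by gcongr
    have h3 : 0 ≤ k ^ 2 / α := by positivity
    nlinarith
  · have hx0 : 0 < ‖x‖ := hε0.trans hx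
    set s := ε / ‖x‖ with hs
    have hs0 : 0 < s := by positivity
    have hs1 : s < 1 := (div_lt_one hx0).2 hx
    have hsx : s * ‖x‖ = ε := div_mul_cancel₀ _ hx0.ne'
    have hconv := hf.2 (Set.mem_univ (0 : EuclideanSpace ℝ (Fin n))) (Set.mem_univ x)
      (sub_nonneg.2 hs1.le) hs0.le (by ring)
    have hp := hnear (s • x) (by rw [norm_smul, Real.norm_of_nonneg hs0.le, hsx])
    simp only [smul_zero, zero_add, zero_sub, norm_neg, smul_eq_mul] at hconv
    have h1 : s * (f 0 - ‖x‖ / ε + α / 2 * (1 - s) * ‖x‖ ^ 2) ≤ s * f x := by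
      have : s * (‖x‖ / ε) = 1 := by rw [← mul_div_assoc, hsx, div_self hε0.ne']
      nlinarith
    have h2 := le_of_mul_le_mul_left h1 hs0
    have h3 : f 0 + α / 2 * ‖x‖ ^ 2 - k * ‖x‖ ≤ f x := by
      refine le_trans (le_of_eq ?_) h2
      rw [hk]
      calc _ = f 0 - ‖x‖ / ε + α / 2 * (‖x‖ ^ 2 - ε * ‖x‖) := by ring
        _ = _ := by rw [← hsx]; ring
    have h4 : k * ‖x‖ ≤ α / 4 * ‖x‖ ^ 2 + k ^ 2 / α := by
      have : 0 ≤ (α / 2 * ‖x‖ - k) ^ 2 / α := by positivity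
      have e : (α / 2 * ‖x‖ - k) ^ 2 / α = α / 4 * ‖x‖ ^ 2 + k ^ 2 / α - k * ‖x‖ := by
        field_simp; ring
      linarith
    have h5 : 0 ≤ α / 4 * ε ^ 2 := by positivity
    linarith

lemma integrable_exp_neg_mul_norm_sq {n : ℕ} {b : ℝ} (hb : 0 < b) :
    Integrable fun x : EuclideanSpace ℝ (Fin n) => Real.exp (-b * ‖x‖ ^ 2) := by
  have := (GaussianFourier.integrable_cexp_neg_mul_sq_norm_add (b := (b : ℂ)) (by simpa using hb) 0
    (0 : EuclideanSpace ℝ (Fin n))).norm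
  refine this.congr (ae_of_all _ fun x => ?_)
  simp [Complex.norm_exp, ← Complex.ofReal_pow]

lemma StrongConvexOn.integrable_exp_neg {n : ℕ} {f : EuclideanSpace ℝ (Fin n) → ℝ} {α : ℝ}
    (hα : 0 < α) (hf : StrongConvexOn Set.univ α f) : Integrable fun x => Real.exp (-f x) := by
  obtain ⟨C, hC⟩ := hf.exists_quadratic_le hα
  have hc := hf.continuous_of_univ hα
  refine ((integrable_exp_neg_mul_norm_sq (n := n) (show 0 < α / 4 by positivity)).mul_const
    (Real.exp C)).mono' (by fun_prop) (ae_of_all _ fun x => ?_)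
  rw [Real.norm_of_nonneg (Real.exp_pos _).le, ← Real.exp_add]
  exact Real.exp_le_exp.2 (by linarith [hC x])

/-- Jensen's inequality for the exponential, with respect to an unnormalized density. -/
lemma exp_div_mul_integral_le {X : Type*} [MeasurableSpace X] {μ : Measure X} {k r : X → ℝ}
    (hk0 : ∀ x, 0 ≤ k x) (hk : Integrable k μ) (hZ : 0 < ∫ x, k x ∂μ)
    (hr : Integrable (fun x => r x * k x) μ) (he : Integrable (fun x => Real.exp (r x) * k x) μ) :
    Real.exp ((∫ x, r x * k x ∂μ) / ∫ x, k x ∂μ) * ∫ x, k x ∂μ ≤ ∫ x, Real.exp (r x) * k x ∂μ := by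
  set m := (∫ x, r x * k x ∂μ) / ∫ x, k x ∂μ with hm
  have h0 : Integrable (fun x => r x * k x - m * k x) μ := hr.sub (hk.const_mul m)
  have h1 : Integrable (fun x => Real.exp m * (k x + (r x * k x - m * k x))) μ :=
    (hk.add h0).const_mul _
  have h2 : ∫ x, Real.exp m * (k x + (r x * k x - m * k x)) ∂μ = Real.exp m * ∫ x, k x ∂μ := by
    rw [integral_const_mul, integral_add hk h0,
      integral_sub hr (hk.const_mul m), integral_const_mul, hm, div_mul_cancel₀ _ hZ.ne']
    ring
  rw [← h2]
  refine integral_mono h1 he fun x => ?_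
  have : Real.exp m * (r x - m + 1) ≤ Real.exp (r x) := by
    calc _ ≤ Real.exp m * Real.exp (r x - m) := by gcongr; exact Real.add_one_le_exp _
      _ = _ := by rw [← Real.exp_add]; congr 1; ring
  have := mul_le_mul_of_nonneg_right this (hk0 x)
  simp only
  linarith

/-- The unnormalized conditional density `exp(−g(y) − ‖x−y‖²/(2η))`. -/
def condDens {n : ℕ} (η : ℝ) (g : EuclideanSpace ℝ (Fin n) → ℝ) (x y : EuclideanSpace ℝ (Fin n)) :
    ℝ :=
  Real.exp (-g y - ‖x - y‖ ^ 2 / (2 * η))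

section Kernel

variable {n : ℕ} {η α : ℝ} {g : EuclideanSpace ℝ (Fin n) → ℝ}

lemma condDens_pos (x y : EuclideanSpace ℝ (Fin n)) : 0 < condDens η g x y := Real.exp_pos _

lemma condDens_le (hη : 0 < η) (x y : EuclideanSpace ℝ (Fin n)) :
    condDens η g x y ≤ Real.exp (-g y) := by
  refine Real.exp_le_exp.2 ?_
  have : 0 ≤ ‖x - y‖ ^ 2 / (2 * η) := by positivity
  linarith

lemma continuous_condDens (hg : Continuous g) :
    Continuous fun p : EuclideanSpace ℝ (Fin n) × EuclideanSpace ℝ (Fin n) =>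
      condDens η g p.1 p.2 := by
  unfold condDens; fun_prop

lemma measurable_condDens (hg : Continuous g) (x : EuclideanSpace ℝ (Fin n)) :
    Measurable (condDens η g x) := by
  unfold condDens
  have := hg.measurable
  fun_prop

lemma integrable_condDens (hη : 0 < η) (hα : 0 < α) (hg : StrongConvexOn Set.univ α g)
    (x : EuclideanSpace ℝ (Fin n)) : Integrable (condDens η g x) := by
  refine (hg.integrable_exp_neg hα).mono'
    (measurable_condDens (hg.continuous_of_univ hα) x).aestronglyMeasurable
    (ae_of_all _ fun y => ?_)
  rw [Real.norm_of_nonneg (condDens_pos x y).le]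
  exact condDens_le hη x y

lemma integral_condDens_pos (hη : 0 < η) (hα : 0 < α) (hg : StrongConvexOn Set.univ α g)
    (x : EuclideanSpace ℝ (Fin n)) : 0 < ∫ y, condDens η g x y :=
  integral_exp_pos (integrable_condDens hη hα hg x)

lemma integrable_mul_condDens (hη : 0 < η) (hα : 0 < α) (hg : StrongConvexOn Set.univ α g)
    {φ : EuclideanSpace ℝ (Fin n) → ℝ} (hφ : Measurable φ) {M : ℝ} (hM : ∀ y, |φ y| ≤ M)
    (x : EuclideanSpace ℝ (Fin n)) : Integrable fun y => φ y * condDens η g x y :=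
  (integrable_condDens hη hα hg x).bdd_mul hφ.aestronglyMeasurable
    (ae_of_all _ fun y => by simpa using hM y)

/-- The log-ratio of the unnormalized conditional densities at `x'` and `x`. -/
def logRatio (η : ℝ) (x x' y : EuclideanSpace ℝ (Fin n)) : ℝ :=
  (‖x - y‖ ^ 2 - ‖x' - y‖ ^ 2) / (2 * η)

lemma exp_logRatio_mul (x x' y : EuclideanSpace ℝ (Fin n)) :
    Real.exp (logRatio η x x' y) * condDens η g x y = condDens η g x' y := by
  rw [condDens, condDens, logRatio, ← Real.exp_add]
  congr 1; ring

lemma logRatio_add_smul (hη : 0 < η) (x v y : EuclideanSpace ℝ (Fin n)) (t : ℝ) :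
    logRatio η x (x + t • v) y =
      t * logRatio η x (x + v) y + t * (1 - t) * ‖v‖ ^ 2 / (2 * η) := by
  have h : ∀ s : ℝ, ‖x + s • v - y‖ ^ 2 = ‖x - y‖ ^ 2 + 2 * s * inner ℝ (x - y) v
      + s ^ 2 * ‖v‖ ^ 2 := by
    intro s
    rw [show x + s • v - y = (x - y) + s • v by abel, norm_add_sq_real, inner_smul_right, norm_smul,
      mul_pow, Real.norm_eq_abs, sq_abs]
    ring
  have h1 := h 1
  rw [one_smul] at h1
  simp only [logRatio]
  rw [h, h1]
  field_simp
  ring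

lemma integrable_logRatio_mul (hη : 0 < η) (hα : 0 < α) (hg : StrongConvexOn Set.univ α g)
    (x x' : EuclideanSpace ℝ (Fin n)) :
    Integrable fun y => logRatio η x x' y * condDens η g x y := by
  have hc := hg.continuous_of_univ hα
  have hm := measurable_condDens (η := η) hc x
  have hneg : ∀ y, Real.exp (-logRatio η x x' y) * condDens η g x y =
      Real.exp (‖x' - x‖ ^ 2 / η) * condDens η g (x - (x' - x)) y := by
    intro y
    have hpar := parallelogram_law_with_norm ℝ (x - y) (x' - x)
    rw [show x - y + (x' - x) = x' - y by abel, show x - y - (x' - x) = x - (x' - x) - y by abel]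
      at hpar
    rw [condDens, condDens, logRatio, ← Real.exp_add, ← Real.exp_add]
    congr 1
    field_simp
    linarith
  refine ((integrable_condDens hη hα hg x').add ((integrable_condDens hη hα hg
    (x - (x' - x))).const_mul (Real.exp (‖x' - x‖ ^ 2 / η)))).mono' ?_ (ae_of_all _ fun y => ?_)
  · unfold logRatio
    fun_prop
  · rw [norm_mul, Real.norm_of_nonneg (condDens_pos x y).le, Real.norm_eq_abs, Pi.add_apply,
      ← hneg y, ← exp_logRatio_mul x x' y, ← add_mul]
    refine mul_le_mul_of_nonneg_right ?_ (condDens_pos x y).le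
    refine abs_le.2 ⟨?_, ?_⟩
    · linarith [Real.add_one_le_exp (-logRatio η x x' y), Real.exp_pos (logRatio η x x' y)]
    · linarith [Real.add_one_le_exp (logRatio η x x' y), Real.exp_pos (-logRatio η x x' y)]

/-- Strong log-concavity of the normalizing constant of the conditional density. -/
lemma integral_condDens_strongLogConcave (hη : 0 < η) (hα : 0 < α)
    (hg : StrongConvexOn Set.univ α g) {a b : ℝ} (ha : 0 < a) (hb : 0 < b) (hab : a + b = 1)
    (x z : EuclideanSpace ℝ (Fin n)) :
    (∫ y, condDens η g x y) ^ a * (∫ y, condDens η g z y) ^ b *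
      Real.exp (α / (2 * (1 + η * α)) * (a * b) * ‖x - z‖ ^ 2) ≤
      ∫ y, condDens η g (a • x + b • z) y := by
  have hc := hg.continuous_of_univ hα
  set κ := α / (2 * (1 + η * α)) * (a * b) * ‖x - z‖ ^ 2 with hκ
  have := prekopa_leindler_integral (F := condDens η g x) (G := condDens η g z)
    (H := fun y => Real.exp (-κ) * condDens η g (a • x + b • z) y) ha hb hab
    (measurable_condDens hc x) (measurable_condDens hc z) ((measurable_condDens hc _).const_mul _)
    (fun y => (condDens_pos x y).le) (fun y => (condDens_pos z y).le)
    (fun y => mul_nonneg (Real.exp_pos _).le (condDens_pos _ y).le) (integrable_condDens hη hα hg x)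
    (integrable_condDens hη hα hg z) ((integrable_condDens hη hα hg _).const_mul _) (by
      intro y w
      simp only [condDens]
      rw [← Real.exp_mul, ← Real.exp_mul, ← Real.exp_add, ← Real.exp_add]
      refine Real.exp_le_exp.2 ?_
      have hconv := hg.2 (Set.mem_univ y) (Set.mem_univ w) ha.le hb.le hab
      simp only [smul_eq_mul] at hconv
      have hsq : ‖a • x + b • z - (a • y + b • w)‖ ^ 2 =
          a * ‖x - y‖ ^ 2 + b * ‖z - w‖ ^ 2 - a * b * ‖(x - z) - (y - w)‖ ^ 2 := by
        rw [show a • x + b • z - (a • y + b • w) = a • (x - y) + b • (z - w) by module,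
          show (x - z) - (y - w) = (x - y) - (z - w) by abel, norm_add_sq_real,
          norm_sub_sq_real (x - y) (z - w),
          norm_smul, norm_smul, inner_smul_left, inner_smul_right, Real.norm_of_nonneg ha.le,
          Real.norm_of_nonneg hb.le]
        simp only [conj_trivial]
        obtain rfl : b = 1 - a := by linarith
        ring
      have hres : α / (2 * (1 + η * α)) * ‖x - z‖ ^ 2 ≤
          α / 2 * ‖y - w‖ ^ 2 + ‖(x - z) - (y - w)‖ ^ 2 / (2 * η) := by
        have h1 : 0 ≤ ‖(1 + η * α) • (y - w) - (x - z)‖ ^ 2 := by positivity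
        rw [norm_sub_sq_real _ (x - z), norm_smul, inner_smul_left,
          Real.norm_of_nonneg (by positivity), mul_pow, conj_trivial] at h1
        rw [norm_sub_sq_real (x - z) (y - w), real_inner_comm (y - w) (x - z)]
        have h2 : α / 2 * ‖y - w‖ ^ 2 + (‖x - z‖ ^ 2 - 2 * inner ℝ (y - w) (x - z)
            + ‖y - w‖ ^ 2) / (2 * η) - α / (2 * (1 + η * α)) * ‖x - z‖ ^ 2 =
            ((1 + η * α) ^ 2 * ‖y - w‖ ^ 2 - 2 * ((1 + η * α) * inner ℝ (y - w) (x - z))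
              + ‖x - z‖ ^ 2) / (2 * η * (1 + η * α)) := by
          have : 1 + η * α ≠ 0 := by positivity
          field_simp
          ring
        have h3 := div_nonneg h1 (show 0 ≤ 2 * η * (1 + η * α) by positivity)
        linarith
      have hres' := mul_le_mul_of_nonneg_left hres (mul_pos ha hb).le
      rw [hsq]
      have e : (a * ‖x - y‖ ^ 2 + b * ‖z - w‖ ^ 2 - a * b * ‖(x - z) - (y - w)‖ ^ 2) / (2 * η) =
        ‖x - y‖ ^ 2 / (2 * η) * a + ‖z - w‖ ^ 2 / (2 * η) * b
          - a * b * (‖(x - z) - (y - w)‖ ^ 2 / (2 * η)) := by ring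
      rw [e, hκ]
      linarith)
  rw [integral_const_mul] at this
  calc _ ≤ (Real.exp (-κ) * ∫ y, condDens η g (a • x + b • z) y) * Real.exp κ := by gcongr
    _ = _ := by rw [mul_right_comm, ← Real.exp_add]; simp

/-- The mean log-ratio is bounded below: a quantitative form of
`D_KL(π^{Y|X=x} ‖ π^{Y|X=x'}) ≤ ‖x - x'‖² / (2η(1 + ηα))`. -/
lemma log_integral_condDens_sub_le (hη : 0 < η) (hα : 0 < α) (hg : StrongConvexOn Set.univ α g)
    (x x' : EuclideanSpace ℝ (Fin n)) :
    Real.log (∫ y, condDens η g x' y) - ‖x - x'‖ ^ 2 / (2 * η * (1 + η * α)) ≤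
      Real.log (∫ y, condDens η g x y) +
        (∫ y, logRatio η x x' y * condDens η g x y) / ∫ y, condDens η g x y := by
  set Z := fun w => ∫ y, condDens η g w y with hZ
  have hZpos : ∀ w, 0 < Z w := integral_condDens_pos hη hα hg
  set m := (∫ y, logRatio η x x' y * condDens η g x y) / ∫ y, condDens η g x y with hm
  set v := x' - x with hv
  have hxv : x' = x + v := by rw [hv]; abel
  have hnorm : ‖x - x'‖ = ‖v‖ := norm_sub_rev _ _
  have hk := integrable_condDens hη hα hg x
  have tangent : ∀ t : ℝ, Real.log (Z x) + (t * m + t * (1 - t) * ‖v‖ ^ 2 / (2 * η)) ≤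
      Real.log (Z (x + t • v)) := by
    intro t
    have hj := exp_div_mul_integral_le (fun y => (condDens_pos x y).le) hk (hZpos x)
      (integrable_logRatio_mul hη hα hg x (x + t • v))
      (by simpa only [exp_logRatio_mul] using integrable_condDens hη hα hg (x + t • v))
    simp only [exp_logRatio_mul] at hj
    have hratio : (∫ y, logRatio η x (x + t • v) y * condDens η g x y) / ∫ y, condDens η g x y =
        t * m + t * (1 - t) * ‖v‖ ^ 2 / (2 * η) := by
      simp only [logRatio_add_smul hη, add_mul, mul_assoc t (logRatio _ _ _ _)]
      rw [integral_add ((hxv ▸ integrable_logRatio_mul hη hα hg x x').const_mul t)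
        (hk.const_mul _), integral_const_mul, integral_const_mul, ← hxv, hm, add_div,
        mul_div_assoc, mul_div_cancel_right₀ _ (hZpos x).ne']
    rw [hratio] at hj
    have := Real.log_le_log (mul_pos (Real.exp_pos _) (hZpos x)) hj
    rw [Real.log_mul (Real.exp_pos _).ne' (hZpos x).ne', Real.log_exp] at this
    linarith
  have step : ∀ t : ℝ, 0 < t → Real.log (Z x') - ‖v‖ ^ 2 / (2 * η * (1 + η * α)) ≤
      Real.log (Z x) + m + t * (‖v‖ ^ 2 / (2 * η)) := by
    intro t ht
    have h1 := tangent (-t)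
    have h2 := integral_condDens_strongLogConcave hη hα hg (a := 1 / (1 + t)) (b := t / (1 + t))
      (by positivity) (by positivity) (by field_simp) (x + (-t) • v) x'
    have e1 : (1 / (1 + t)) • (x + (-t) • v) + (t / (1 + t)) • x' = x := by
      rw [hxv]
      have e : (1 / (1 + t)) • (x + (-t) • v) + (t / (1 + t)) • (x + v) =
          ((1 + t) / (1 + t)) • x := by module
      rw [e, div_self (by positivity), one_smul]
    have e2 : ‖x + (-t) • v - x'‖ ^ 2 = (1 + t) ^ 2 * ‖v‖ ^ 2 := by
      rw [hxv, show x + (-t) • v - (x + v) = (-(1 + t)) • v by module, norm_smul, mul_pow,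
        Real.norm_eq_abs, sq_abs]
      ring
    rw [e1, e2] at h2
    change Z _ ^ _ * Z _ ^ _ * _ ≤ Z x at h2
    have h3 := Real.log_le_log (by have := hZpos (x + (-t) • v); have := hZpos x'; positivity) h2
    rw [Real.log_mul (by have := hZpos (x + (-t) • v); have := hZpos x'; positivity)
      (Real.exp_pos _).ne', Real.log_mul (Real.rpow_pos_of_pos (hZpos _) _).ne'
      (Real.rpow_pos_of_pos (hZpos _) _).ne', Real.log_rpow (hZpos _), Real.log_rpow (hZpos _),
      Real.log_exp] at h3
    set ℓ := Real.log (Z x)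
    set ℓ' := Real.log (Z x')
    set ℓt := Real.log (Z (x + (-t) • v))
    have h4 : ℓt + t * ℓ' + α / (2 * (1 + η * α)) * t * (1 + t) * ‖v‖ ^ 2 ≤ (1 + t) * ℓ := by
      calc _ = (1 + t) * (1 / (1 + t) * ℓt + t / (1 + t) * ℓ' + α / (2 * (1 + η * α)) *
            (1 / (1 + t) * (t / (1 + t))) * ((1 + t) ^ 2 * ‖v‖ ^ 2)) := by
              have : 1 + η * α ≠ 0 := by positivity
              field_simp
        _ ≤ _ := by gcongr
    have h5 : t * (ℓ' + α / (2 * (1 + η * α)) * (1 + t) * ‖v‖ ^ 2) ≤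
        t * (ℓ + m + (1 + t) * ‖v‖ ^ 2 / (2 * η)) := by
      have : t * (ℓ + m + (1 + t) * ‖v‖ ^ 2 / (2 * η)) =
        t * ℓ + t * m - (-t) * (1 - -t) * ‖v‖ ^ 2 / (2 * η) := by ring
      rw [this]
      linarith
    have h6 := le_of_mul_le_mul_left h5 ht
    have h7 : ‖v‖ ^ 2 / (2 * η * (1 + η * α)) =
        ‖v‖ ^ 2 / (2 * η) - α / (2 * (1 + η * α)) * ‖v‖ ^ 2 := by
      have : 1 + η * α ≠ 0 := by positivity
      field_simp
      ring
    have h8 : 0 ≤ α / (2 * (1 + η * α)) * t * ‖v‖ ^ 2 := by positivity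
    have h9 : (1 + t) * ‖v‖ ^ 2 / (2 * η) = ‖v‖ ^ 2 / (2 * η) + t * (‖v‖ ^ 2 / (2 * η)) := by ring
    rw [h7]
    linarith
  rw [hnorm]
  have hlim : Filter.Tendsto (fun t : ℝ => Real.log (Z x) + m + t * (‖v‖ ^ 2 / (2 * η)))
      (nhdsWithin 0 (Set.Ioi 0)) (nhds (Real.log (Z x) + m)) := by
    have : Filter.Tendsto (fun t : ℝ => Real.log (Z x) + m + t * (‖v‖ ^ 2 / (2 * η)))
      (nhds 0) (nhds (Real.log (Z x) + m + 0 * (‖v‖ ^ 2 / (2 * η)))) :=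
      Continuous.tendsto (by fun_prop) 0
    simpa using this.mono_left nhdsWithin_le_nhds
  exact ge_of_tendsto hlim (eventually_nhdsWithin_of_forall step)

lemma exp_mean_sub_mul_le (hη : 0 < η) (hα : 0 < α) (hg : StrongConvexOn Set.univ α g)
    {φ : EuclideanSpace ℝ (Fin n) → ℝ} (hφ : Measurable φ) {M : ℝ} (hM : ∀ y, |φ y| ≤ M)
    (x x' : EuclideanSpace ℝ (Fin n)) :
    Real.exp ((∫ y, φ y * condDens η g x y) / (∫ y, condDens η g x y)
      - ‖x - x'‖ ^ 2 / (2 * η * (1 + η * α))) * ∫ y, condDens η g x' y ≤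
      ∫ y, Real.exp (φ y) * condDens η g x' y := by
  have hφi := integrable_mul_condDens hη hα hg hφ hM x
  have hri := integrable_logRatio_mul hη hα hg x x'
  have hZ := integral_condDens_pos hη hα hg x
  have hZ' := integral_condDens_pos hη hα hg x'
  have e : ∀ y, Real.exp (φ y + logRatio η x x' y) * condDens η g x y =
      Real.exp (φ y) * condDens η g x' y := by
    intro y
    rw [Real.exp_add, mul_assoc, exp_logRatio_mul]
  have hj : Real.exp ((∫ y, φ y * condDens η g x y) / (∫ y, condDens η g x y) +
      (∫ y, logRatio η x x' y * condDens η g x y) / (∫ y, condDens η g x y)) *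
      ∫ y, condDens η g x y ≤ ∫ y, Real.exp (φ y) * condDens η g x' y := by
    have hj' := exp_div_mul_integral_le (r := fun y => φ y + logRatio η x x' y)
      (fun y => (condDens_pos x y).le) (integrable_condDens hη hα hg x) hZ
      (by simp only [add_mul]; exact hφi.add hri)
      (by
        simp only [e]
        refine integrable_mul_condDens hη hα hg (M := Real.exp M) (by fun_prop) (fun y => ?_) x'
        rw [Real.abs_exp]
        exact Real.exp_le_exp.2 ((le_abs_self _).trans (hM y)))
    simp only [e, add_mul] at hj'
    rw [integral_add hφi hri, add_div] at hj'
    exact hj'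
  refine le_trans ?_ hj
  have hmain := log_integral_condDens_sub_le hη hα hg x x'
  set Z := ∫ y, condDens η g x y
  set Z' := ∫ y, condDens η g x' y
  calc _ = Real.exp ((∫ y, φ y * condDens η g x y) / Z - ‖x - x'‖ ^ 2 / (2 * η * (1 + η * α))
        + Real.log Z') := by rw [Real.exp_add, Real.exp_log hZ']
    _ ≤ Real.exp ((∫ y, φ y * condDens η g x y) / Z +
        (∫ y, logRatio η x x' y * condDens η g x y) / Z + Real.log Z) :=
      Real.exp_le_exp.2 (by linarith)
    _ = _ := by rw [Real.exp_add _ (Real.log Z), Real.exp_log hZ]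

end Kernel

lemma StrongConvexOn.exp_neg_rpow_mul_le {n : ℕ} {f : EuclideanSpace ℝ (Fin n) → ℝ} {α : ℝ}
    (hf : StrongConvexOn Set.univ α f) {a b : ℝ} (ha : 0 < a) (hb : 0 < b) (hab : a + b = 1)
    (x z : EuclideanSpace ℝ (Fin n)) :
    Real.exp (-f x) ^ a * Real.exp (-f z) ^ b * Real.exp (α / 2 * (a * b) * ‖x - z‖ ^ 2) ≤
      Real.exp (-f (a • x + b • z)) := by
  have hconv := hf.2 (Set.mem_univ x) (Set.mem_univ z) ha.le hb.le hab
  simp only [smul_eq_mul] at hconv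
  rw [← Real.exp_mul, ← Real.exp_mul, ← Real.exp_add, ← Real.exp_add]
  exact Real.exp_le_exp.2 (by linarith)

section Functional

variable {n : ℕ} {η αf αg : ℝ} {f g : EuclideanSpace ℝ (Fin n) → ℝ}

lemma measurable_integral_mul_condDens (hg : Continuous g) {φ : EuclideanSpace ℝ (Fin n) → ℝ}
    (hφ : Measurable φ) : Measurable fun x => ∫ y, φ y * condDens η g x y := by
  have h : Measurable fun p : EuclideanSpace ℝ (Fin n) × EuclideanSpace ℝ (Fin n) =>
      φ p.2 * condDens η g p.1 p.2 :=
    (hφ.comp measurable_snd).mul (continuous_condDens hg).measurable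
  exact (StronglyMeasurable.integral_prod_right' (ν := volume) h.stronglyMeasurable).measurable

lemma measurable_integral_condDens (hg : Continuous g) :
    Measurable fun x => ∫ y, condDens η g x y := by
  simpa using measurable_integral_mul_condDens (η := η) hg (φ := fun _ => 1) measurable_const

lemma abs_integral_mul_condDens_le (hη : 0 < η) (hα : 0 < αg) (hg : StrongConvexOn Set.univ αg g)
    {φ : EuclideanSpace ℝ (Fin n) → ℝ} (hφ : Measurable φ) {M : ℝ} (hM : ∀ y, |φ y| ≤ M)
    (x : EuclideanSpace ℝ (Fin n)) :
    |∫ y, φ y * condDens η g x y| ≤ M * ∫ y, condDens η g x y := by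
  rw [← integral_const_mul, ← Real.norm_eq_abs]
  refine (norm_integral_le_integral_norm _).trans (integral_mono
    (integrable_mul_condDens hη hα hg hφ hM x).norm ((integrable_condDens hη hα hg x).const_mul M)
    fun y => ?_)
  simp only [norm_mul, Real.norm_eq_abs, abs_of_pos (condDens_pos (η := η) (g := g) x y)]
  exact mul_le_mul_of_nonneg_right (hM y) (condDens_pos x y).le

lemma integrable_exp_neg_mul_integral (hη : 0 < η) (hαf : 0 < αf) (hαg : 0 < αg)
    (hf : StrongConvexOn Set.univ αf f) (hg : StrongConvexOn Set.univ αg g)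
    {φ : EuclideanSpace ℝ (Fin n) → ℝ} (hφ : Measurable φ) {M : ℝ} (hM : ∀ y, |φ y| ≤ M) :
    Integrable fun x => Real.exp (-f x) * ∫ y, φ y * condDens η g x y := by
  have hfm := (hf.continuous_of_univ hαf).measurable
  have hM0 : 0 ≤ M := (abs_nonneg _).trans (hM 0)
  refine ((hf.integrable_exp_neg hαf).mul_const (M * ∫ y, Real.exp (-g y))).mono'
    ((hfm.neg.exp).mul
      (measurable_integral_mul_condDens (hg.continuous_of_univ hαg) hφ)).aestronglyMeasurable
    (ae_of_all _ fun x => ?_)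
  rw [norm_mul, Real.norm_of_nonneg (Real.exp_pos _).le, Real.norm_eq_abs]
  refine mul_le_mul_of_nonneg_left ?_ (Real.exp_pos _).le
  refine (abs_integral_mul_condDens_le hη hαg hg hφ hM x).trans ?_
  exact mul_le_mul_of_nonneg_left (integral_mono (integrable_condDens hη hαg hg x)
    (hg.integrable_exp_neg hαg) fun y => condDens_le hη x y) hM0

lemma integrable_exp_neg_mul_integral_condDens (hη : 0 < η) (hαf : 0 < αf) (hαg : 0 < αg)
    (hf : StrongConvexOn Set.univ αf f) (hg : StrongConvexOn Set.univ αg g) :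
    Integrable fun x => Real.exp (-f x) * ∫ y, condDens η g x y := by
  simpa using integrable_exp_neg_mul_integral hη hαf hαg hf hg (φ := fun _ => 1) (M := 1)
    measurable_const (by simp)

/-- The conditional expectation of `φ(Y)` given `X = x`. -/
def condMean (η : ℝ) (g φ : EuclideanSpace ℝ (Fin n) → ℝ) (x : EuclideanSpace ℝ (Fin n)) : ℝ :=
  (∫ y, φ y * condDens η g x y) / ∫ y, condDens η g x y

lemma measurable_condMean (hg : Continuous g) {φ : EuclideanSpace ℝ (Fin n) → ℝ}
    (hφ : Measurable φ) : Measurable (condMean η g φ) :=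
  (measurable_integral_mul_condDens hg hφ).div (measurable_integral_condDens hg)

lemma abs_condMean_le (hη : 0 < η) (hα : 0 < αg) (hg : StrongConvexOn Set.univ αg g)
    {φ : EuclideanSpace ℝ (Fin n) → ℝ} (hφ : Measurable φ) {M : ℝ} (hM : ∀ y, |φ y| ≤ M)
    (x : EuclideanSpace ℝ (Fin n)) : |condMean η g φ x| ≤ M := by
  have hZ := integral_condDens_pos hη hα hg x
  rw [condMean, abs_div, abs_of_pos hZ, div_le_iff₀ hZ]
  exact abs_integral_mul_condDens_le hη hα hg hφ hM x

/-- The dual (functional) form of the contraction inequality. -/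
lemma integral_exp_condMean_rpow_mul_le (hη : 0 < η) (hαf : 0 < αf) (hαg : 0 < αg)
    (hf : StrongConvexOn Set.univ αf f) (hg : StrongConvexOn Set.univ αg g)
    {φ : EuclideanSpace ℝ (Fin n) → ℝ} (hφ : Measurable φ) {M : ℝ} (hM : ∀ y, |φ y| ≤ M)
    {L c : ℝ} (hL : L = (1 + η * αf) * (1 + η * αg)) (hc : c = 1 / L) :
    (∫ x, Real.exp (L * condMean η g φ x) * (Real.exp (-f x) * ∫ y, condDens η g x y)) ^ c *
      (∫ x, Real.exp (-f x) * ∫ y, condDens η g x y) ^ (1 - c) ≤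
      ∫ x, Real.exp (-f x) * ∫ y, Real.exp (φ y) * condDens η g x y := by
  have hfm := (hf.continuous_of_univ hαf).measurable
  have hgc := hg.continuous_of_univ hαg
  have hum : Measurable (condMean η g φ) := measurable_condMean hgc hφ
  have hZm := measurable_integral_condDens (η := η) hgc
  have hZ := integral_condDens_pos hη hαg hg
  have hρ := integrable_exp_neg_mul_integral_condDens hη hαf hαg hf hg
  have hL1 : 1 < L := by
    rw [hL]
    have h1 := mul_pos hη hαf
    have h2 := mul_pos hη hαg
    nlinarith [mul_pos h1 h2]
  have hL0 : 0 < L := one_pos.trans hL1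
  have hc0 : 0 < c := by rw [hc]; positivity
  have hc1 : 0 < 1 - c := by rw [hc, sub_pos, div_lt_one hL0]; exact hL1
  have hLc : L * c = 1 := by rw [hc]; field_simp
  have hexpM : ∀ y, |Real.exp (φ y)| ≤ Real.exp M := fun y => by
    rw [Real.abs_exp]
    exact Real.exp_le_exp.2 ((le_abs_self _).trans (hM y))
  refine prekopa_leindler_integral hc0 hc1 (by ring)
    (by fun_prop) (by fun_prop)
    (hfm.neg.exp.mul (measurable_integral_mul_condDens hgc hφ.exp))
    (fun x => mul_nonneg (Real.exp_pos _).le (mul_pos (Real.exp_pos _) (hZ x)).le)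
    (fun x => (mul_pos (Real.exp_pos _) (hZ x)).le)
    (fun x => mul_nonneg (Real.exp_pos _).le (integral_nonneg fun y =>
      (mul_pos (Real.exp_pos _) (condDens_pos x y)).le))
    (hρ.bdd_mul (c := Real.exp (L * M)) (by fun_prop) (ae_of_all _ fun x => ?_)) hρ
    (integrable_exp_neg_mul_integral hη hαf hαg hf hg hφ.exp hexpM) fun x z => ?_
  · rw [Real.norm_of_nonneg (Real.exp_pos _).le]
    refine Real.exp_le_exp.2 (mul_le_mul_of_nonneg_left ?_ hL0.le)
    exact (le_abs_self _).trans (abs_condMean_le hη hαg hg hφ hM x)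
  · set p := c • x + (1 - c) • z with hp
    have h1 := hf.exp_neg_rpow_mul_le hc0 hc1 (by ring) x z
    have h2 := integral_condDens_strongLogConcave hη hαg hg hc0 hc1 (by ring) x z
    have h3 := exp_mean_sub_mul_le hη hαg hg hφ hM x p
    rw [← hp] at h1 h2
    have hxp : ‖x - p‖ ^ 2 = (1 - c) ^ 2 * ‖x - z‖ ^ 2 := by
      rw [hp, show x - (c • x + (1 - c) • z) = (1 - c) • (x - z) by module, norm_smul, mul_pow,
        Real.norm_of_nonneg hc1.le]
    rw [hxp] at h3
    change Real.exp (condMean η g φ x - _) * _ ≤ _ at h3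
    have hexp : Real.exp (αf / 2 * (c * (1 - c)) * ‖x - z‖ ^ 2) *
        Real.exp (αg / (2 * (1 + η * αg)) * (c * (1 - c)) * ‖x - z‖ ^ 2) *
        Real.exp (condMean η g φ x - (1 - c) ^ 2 * ‖x - z‖ ^ 2 / (2 * η * (1 + η * αg))) =
        Real.exp (L * condMean η g φ x) ^ c := by
      rw [← Real.exp_mul, ← Real.exp_add, ← Real.exp_add]
      congr 1
      have hA : 1 + η * αf ≠ 0 := by positivity
      have hB : 1 + η * αg ≠ 0 := by positivity
      have : αf / 2 * (c * (1 - c)) + αg / (2 * (1 + η * αg)) * (c * (1 - c)) =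
          (1 - c) ^ 2 / (2 * η * (1 + η * αg)) := by
        rw [hc, hL]
        field_simp
        ring
      linear_combination (‖x - z‖ ^ 2) * this - condMean η g φ x * hLc
    rw [Real.mul_rpow (Real.exp_pos _).le (mul_pos (Real.exp_pos _) (hZ x)).le,
      Real.mul_rpow (Real.exp_pos _).le (hZ x).le, Real.mul_rpow (Real.exp_pos _).le (hZ z).le,
      ← hexp]
    have hZx := Real.rpow_nonneg (hZ x).le c
    have hZz := Real.rpow_nonneg (hZ z).le (1 - c)
    calc _ = (Real.exp (-f x) ^ c * Real.exp (-f z) ^ (1 - c) *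
          Real.exp (αf / 2 * (c * (1 - c)) * ‖x - z‖ ^ 2)) *
          (Real.exp (condMean η g φ x - (1 - c) ^ 2 * ‖x - z‖ ^ 2 / (2 * η * (1 + η * αg))) *
          ((∫ y, condDens η g x y) ^ c * (∫ y, condDens η g z y) ^ (1 - c) *
          Real.exp (αg / (2 * (1 + η * αg)) * (c * (1 - c)) * ‖x - z‖ ^ 2))) := by ring
      _ ≤ Real.exp (-f p) *
          (Real.exp (condMean η g φ x - (1 - c) ^ 2 * ‖x - z‖ ^ 2 / (2 * η * (1 + η * αg))) *
          ∫ y, condDens η g p y) := by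
        refine mul_le_mul h1 (mul_le_mul_of_nonneg_left h2 (Real.exp_pos _).le)
          ?_ (Real.exp_pos _).le
        positivity
      _ ≤ _ := mul_le_mul_of_nonneg_left h3 (Real.exp_pos _).le

end Functional

/-- Fenchel–Young inequality for `t log t - t` and `exp`. -/
lemma mul_le_mul_log_sub_add_exp {t : ℝ} (ht : 0 ≤ t) (w : ℝ) :
    t * w ≤ t * Real.log t - t + Real.exp w := by
  rcases ht.eq_or_lt with rfl | ht
  · simpa using (Real.exp_pos w).le
  have h := Real.add_one_le_exp (w - Real.log t)
  rw [Real.exp_sub, Real.exp_log ht, le_div_iff₀ ht] at h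
  linarith

lemma abs_exp_le {X : Type*} {w : X → ℝ} {M : ℝ} (hM : ∀ x, |w x| ≤ M) (x : X) :
    |Real.exp (w x)| ≤ Real.exp M := by
  rw [abs_of_pos (Real.exp_pos _)]
  exact Real.exp_le_exp.2 ((le_abs_self _).trans (hM x))

section Duality

variable {X : Type*} [MeasurableSpace X] {μ ν : Measure X}

lemma integrable_of_abs_le [IsFiniteMeasure μ] {w : X → ℝ} (hw : Measurable w) {M : ℝ}
    (hM : ∀ x, |w x| ≤ M) : Integrable w μ :=
  Integrable.of_bound hw.aestronglyMeasurable M (ae_of_all _ fun x => by simpa using hM x)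

/-- The easy half of the Donsker–Varadhan variational formula. -/
lemma integral_le_toReal_klDiv_add_log [IsProbabilityMeasure μ] [IsProbabilityMeasure ν]
    (hμν : μ ≪ ν) (hfin : klDiv μ ν < ⊤) {w : X → ℝ} (hw : Measurable w) {M : ℝ}
    (hM : ∀ x, |w x| ≤ M) :
    ∫ x, w x ∂μ ≤ (klDiv μ ν).toReal + Real.log (∫ x, Real.exp (w x) ∂ν) := by
  have hwi : Integrable w μ := integrable_of_abs_le hw hM
  have hei : Integrable (fun x => Real.exp (w x)) ν := integrable_of_abs_le hw.exp (abs_exp_le hM)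
  have hE : 0 < ∫ x, Real.exp (w x) ∂ν := integral_exp_pos hei
  set E := ∫ x, Real.exp (w x) ∂ν with hEdef
  set h : X → ℝ := fun x => (μ.rnDeriv ν x).toReal with hh
  have hh0 : ∀ x, 0 ≤ h x := fun x => ENNReal.toReal_nonneg
  have hhm : Measurable h := (Measure.measurable_rnDeriv μ ν).ennreal_toReal
  have hkm : Measurable fun x => h x * Real.log (h x) - h x + 1 := by fun_prop
  have hk0 : ∀ x, 0 ≤ h x * Real.log (h x) - h x + 1 := fun x => by
    simpa using mul_le_mul_log_sub_add_exp (hh0 x) 0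
  rw [klDiv, if_pos hμν] at hfin ⊢
  have hki : Integrable (fun x => h x * Real.log (h x) - h x + 1) ν :=
    ⟨hkm.aestronglyMeasurable, by
      rwa [hasFiniteIntegral_iff_ofReal (ae_of_all _ hk0)]⟩
  rw [← integral_eq_lintegral_of_nonneg_ae (ae_of_all _ hk0) hkm.aestronglyMeasurable]
  have hli : Integrable (fun x => h x * (w x - Real.log E)) ν :=
    (integrable_toReal_rnDeriv_mul_iff hμν).2 (hwi.sub (integrable_const _))
  have hri : Integrable (fun x => Real.exp (w x) * E⁻¹ - 1) ν :=
    (hei.mul_const _).sub (integrable_const _)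
  have key : ∫ x, h x * (w x - Real.log E) ∂ν ≤
      ∫ x, (h x * Real.log (h x) - h x + 1) + (Real.exp (w x) * E⁻¹ - 1) ∂ν := by
    refine integral_mono hli (hki.add hri) fun x => ?_
    have := mul_le_mul_log_sub_add_exp (hh0 x) (w x - Real.log E)
    rw [Real.exp_sub, Real.exp_log hE, div_eq_mul_inv] at this
    simp only
    linarith
  rw [integral_toReal_rnDeriv_mul hμν, integral_sub hwi (integrable_const _),
    integral_add hki hri,
    integral_sub (hei.mul_const _) (integrable_const _), integral_mul_const, ← hEdef,
    mul_inv_cancel₀ hE.ne'] at key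
  simp only [integral_const, probReal_univ, smul_eq_mul, mul_one, one_mul, sub_self, add_zero]
    at key
  linarith

/-- The hard half of the Donsker–Varadhan variational formula. -/
lemma klDiv_le_ofReal_of_forall_integral_le [IsProbabilityMeasure μ] [IsProbabilityMeasure ν]
    (hμν : μ ≪ ν) {K : ℝ} (H : ∀ φ : X → ℝ, Measurable φ → (∃ M, ∀ x, |φ x| ≤ M) →
      ∫ x, φ x ∂μ ≤ K + Real.log (∫ x, Real.exp (φ x) ∂ν)) :
    klDiv μ ν ≤ ENNReal.ofReal K := by
  set h : X → ℝ := fun x => (μ.rnDeriv ν x).toReal with hh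
  have hh0 : ∀ x, 0 ≤ h x := fun x => ENNReal.toReal_nonneg
  have hhm : Measurable h := (Measure.measurable_rnDeriv μ ν).ennreal_toReal
  set ψ : ℕ → X → ℝ := fun n x => max (1 / ((n : ℝ) + 1)) (min (h x) (n + 1)) with hψ
  have hψpos : ∀ n x, 0 < ψ n x := fun n x => lt_max_of_lt_left (by positivity)
  have hψm : ∀ n, Measurable (ψ n) := fun n => by fun_prop
  have hψle : ∀ n x, ψ n x ≤ n + 1 := fun n x => by
    refine max_le ?_ (min_le_right _ _)
    rw [div_le_iff₀ (by positivity)]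
    nlinarith [Nat.cast_nonneg (α := ℝ) n]
  have hbound : ∀ n x, |Real.log (ψ n x)| ≤ Real.log (n + 1) := fun n x => by
    rw [abs_le]
    refine ⟨?_, Real.log_le_log (hψpos n x) (hψle n x)⟩
    rw [← Real.log_inv, ← one_div]
    exact Real.log_le_log (by positivity) (le_max_left _ _)
  set F : ℕ → X → ℝ := fun n x => h x * Real.log (ψ n x) - ψ n x + 1 with hF
  have hFm : ∀ n, Measurable (F n) := fun n => by
    have := hψm n
    fun_prop
  have hF0 : ∀ n x, 0 ≤ F n x := fun n x => by
    have hl' := Real.one_sub_inv_le_log_of_pos (hψpos n x)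
    have h1 : ψ n x * (1 - (ψ n x)⁻¹) = ψ n x - 1 := by
      rw [mul_sub, mul_inv_cancel₀ (hψpos n x).ne', mul_one]
    have h2 : ψ n x * (1 - (ψ n x)⁻¹) ≤ ψ n x * Real.log (ψ n x) :=
      mul_le_mul_of_nonneg_left hl' (hψpos n x).le
    have h3 : 0 ≤ (h x - ψ n x) * Real.log (ψ n x) := by
      have hn : (1 : ℝ) ≤ n + 1 := by linarith [Nat.cast_nonneg (α := ℝ) n]
      have hn' : 1 / ((n : ℝ) + 1) ≤ 1 := by rw [div_le_one (by positivity)]; exact hn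
      rcases le_total (h x) (ψ n x) with hle | hle
      · rcases hle.eq_or_lt with heq | hlt
        · simp [heq]
        have : ψ n x ≤ 1 := by
          refine max_le hn' ?_
          by_contra hcon
          push Not at hcon
          have : ψ n x = min (h x) (n + 1) := max_eq_right (hn'.trans hcon.le)
          rw [this] at hlt
          exact absurd (min_le_left (h x) ((n : ℝ) + 1)) (not_le.2 hlt)
        exact mul_nonneg_of_nonpos_of_nonpos (by linarith)
          (Real.log_nonpos (hψpos n x).le this)
      · rcases hle.eq_or_lt with heq | hlt
        · simp [heq]
        have : 1 ≤ ψ n x := by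
          have hmin : min (h x) ((n : ℝ) + 1) < h x := (le_max_right _ _).trans_lt hlt
          have : min (h x) ((n : ℝ) + 1) = n + 1 := by
            rcases min_choice (h x) ((n : ℝ) + 1) with h' | h'
            · rw [h'] at hmin; exact absurd hmin (lt_irrefl _)
            · exact h'
          exact hn.trans (this ▸ le_max_right _ _)
        exact mul_nonneg (by linarith) (Real.log_nonneg this)
    simp only [hF]
    linarith
  have hψi : ∀ n, Integrable (ψ n) ν := fun n => integrable_of_abs_le (hψm n) fun x => by
    rw [abs_of_pos (hψpos n x)]; exact hψle n x
  have hli : ∀ n, Integrable (fun x => h x * Real.log (ψ n x)) ν := fun n =>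
    (integrable_toReal_rnDeriv_mul_iff hμν).2 (integrable_of_abs_le (hψm n).log (hbound n))
  have hsub : ∀ n, Integrable (fun x => h x * Real.log (ψ n x) - ψ n x) ν := fun n =>
    (hli n).sub (hψi n)
  have hFint : ∀ n, ∫ x, F n x ∂ν ≤ K := fun n => by
    have hH := H (fun x => Real.log (ψ n x)) (hψm n).log ⟨_, hbound n⟩
    simp only [Real.exp_log (hψpos n _)] at hH
    have hpos : 0 < ∫ x, ψ n x ∂ν := by
      have := integral_exp_pos (μ := ν) (f := fun x => Real.log (ψ n x))
        (by simpa only [Real.exp_log (hψpos n _)] using hψi n)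
      simpa only [Real.exp_log (hψpos n _)] using this
    have hlog := Real.log_le_sub_one_of_pos hpos
    simp only [hF]
    rw [integral_add (hsub n) (integrable_const _), integral_sub (hli n) (hψi n),
      integral_toReal_rnDeriv_mul hμν]
    simp only [integral_const, probReal_univ, smul_eq_mul, mul_one]
    linarith
  have hlim : ∀ x, Filter.Tendsto (fun n => F n x) Filter.atTop
      (nhds (h x * Real.log (h x) - h x + 1)) := fun x => by
    have hψt : Filter.Tendsto (fun n => ψ n x) Filter.atTop (nhds (h x)) := by
      have h1 : Filter.Tendsto (fun n : ℕ => max (1 / ((n : ℝ) + 1)) (h x)) Filter.atTop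
          (nhds (max 0 (h x))) := tendsto_one_div_add_atTop_nhds_zero_nat.max tendsto_const_nhds
      rw [max_eq_right (hh0 x)] at h1
      refine h1.congr' ?_
      filter_upwards [Filter.eventually_ge_atTop ⌈h x⌉₊] with n hn
      have : h x ≤ (n : ℝ) + 1 := ((Nat.le_ceil _).trans (Nat.cast_le.2 hn)).trans (by linarith)
      simp only [hψ, min_eq_left this]
    have hlt : Filter.Tendsto (fun n => h x * Real.log (ψ n x)) Filter.atTop
        (nhds (h x * Real.log (h x))) := by
      rcases (hh0 x).eq_or_lt with h0 | h0
      · simp [← h0]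
      · exact (hψt.log h0.ne').const_mul _
    exact (hlt.sub hψt).add_const 1
  rw [klDiv, if_pos hμν]
  calc ∫⁻ x, ENNReal.ofReal (h x * Real.log (h x) - h x + 1) ∂ν
      = ∫⁻ x, Filter.liminf (fun n => ENNReal.ofReal (F n x)) Filter.atTop ∂ν := by
        refine lintegral_congr fun x => ?_
        exact (((ENNReal.continuous_ofReal.tendsto _).comp (hlim x)).liminf_eq).symm
    _ ≤ Filter.liminf (fun n => ∫⁻ x, ENNReal.ofReal (F n x) ∂ν) Filter.atTop :=
        lintegral_liminf_le fun n => (hFm n).ennreal_ofReal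
    _ ≤ Filter.liminf (fun _ : ℕ => ENNReal.ofReal K) Filter.atTop := by
        refine Filter.liminf_le_liminf (Filter.Eventually.of_forall fun n => ?_)
        have hFi : Integrable (F n) ν := (hsub n).add (integrable_const 1)
        rw [← ofReal_integral_eq_lintegral_ofReal hFi (ae_of_all _ (hF0 n))]
        exact ENNReal.ofReal_le_ofReal (hFint n)
    _ = ENNReal.ofReal K := Filter.liminf_const _

end Duality

section Target

variable {n : ℕ} {η αf αg : ℝ} {f g : EuclideanSpace ℝ (Fin n) → ℝ}

lemma jointDens_eq (p : EuclideanSpace ℝ (Fin n) × EuclideanSpace ℝ (Fin n)) :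
    jointDens n η f g p = Real.exp (-f p.1) * condDens η g p.1 p.2 := by
  rw [jointDens, condDens, ← Real.exp_add]
  congr 1; ring

lemma jointDens_pos (p : EuclideanSpace ℝ (Fin n) × EuclideanSpace ℝ (Fin n)) :
    0 < jointDens n η f g p := Real.exp_pos _

lemma measurable_jointDens (hf : Continuous f) (hg : Continuous g) :
    Measurable (jointDens n η f g) := by
  have : Continuous (jointDens n η f g) := by unfold jointDens; fun_prop
  exact this.measurable

lemma integrable_jointDens (hη : 0 < η) (hαf : 0 < αf) (hαg : 0 < αg)
    (hf : StrongConvexOn Set.univ αf f) (hg : StrongConvexOn Set.univ αg g) :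
    Integrable (jointDens n η f g) := by
  refine ((hf.integrable_exp_neg hαf).mul_prod (hg.integrable_exp_neg hαg)).mono'
    (measurable_jointDens (hf.continuous_of_univ hαf)
      (hg.continuous_of_univ hαg)).aestronglyMeasurable (ae_of_all _ fun p => ?_)
  rw [Real.norm_of_nonneg (jointDens_pos p).le, jointDens_eq]
  exact mul_le_mul_of_nonneg_left (condDens_le hη _ _) (Real.exp_pos _).le

lemma integral_mul_jointDens (hη : 0 < η) (hαf : 0 < αf) (hαg : 0 < αg)
    (hf : StrongConvexOn Set.univ αf f) (hg : StrongConvexOn Set.univ αg g)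
    {F : EuclideanSpace ℝ (Fin n) × EuclideanSpace ℝ (Fin n) → ℝ} (hF : Measurable F) {M : ℝ}
    (hM : ∀ p, |F p| ≤ M) :
    ∫ p, F p * jointDens n η f g p =
      ∫ x, Real.exp (-f x) * ∫ y, F (x, y) * condDens η g x y := by
  have hi : Integrable (fun p => F p * jointDens n η f g p) :=
    (integrable_jointDens hη hαf hαg hf hg).bdd_mul hF.aestronglyMeasurable
      (ae_of_all _ fun p => by simpa using hM p)
  rw [Measure.volume_eq_prod] at hi ⊢
  rw [integral_prod _ hi]
  refine integral_congr_ae (ae_of_all _ fun x => ?_)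
  simp only
  rw [← integral_const_mul]
  refine integral_congr_ae (ae_of_all _ fun y => ?_)
  simp only [jointDens_eq]
  ring

lemma integral_jointDens (hη : 0 < η) (hαf : 0 < αf) (hαg : 0 < αg)
    (hf : StrongConvexOn Set.univ αf f) (hg : StrongConvexOn Set.univ αg g) :
    ∫ p, jointDens n η f g p = ∫ x, Real.exp (-f x) * ∫ y, condDens η g x y := by
  simpa using integral_mul_jointDens hη hαf hαg hf hg (F := fun _ => 1) (M := 1)
    measurable_const (by simp)

lemma integral_jointDens_pos (hη : 0 < η) (hαf : 0 < αf) (hαg : 0 < αg)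
    (hf : StrongConvexOn Set.univ αf f) (hg : StrongConvexOn Set.univ αg g) :
    0 < ∫ p, jointDens n η f g p :=
  integral_exp_pos (integrable_jointDens hη hαf hαg hf hg)

lemma isProbabilityMeasure_targetXY (hη : 0 < η) (hαf : 0 < αf) (hαg : 0 < αg)
    (hf : StrongConvexOn Set.univ αf f) (hg : StrongConvexOn Set.univ αg g) :
    IsProbabilityMeasure (targetXY n η f g) := by
  have hN := integral_jointDens_pos hη hαf hαg hf hg
  refine ⟨?_⟩
  rw [targetXY, withDensity_apply _ MeasurableSet.univ, setLIntegral_univ,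
    ← ofReal_integral_eq_lintegral_ofReal ((integrable_jointDens hη hαf hαg hf hg).div_const _)
      (ae_of_all _ fun p => div_nonneg (jointDens_pos p).le hN.le),
    integral_div, div_self hN.ne', ENNReal.ofReal_one]

lemma integral_targetXY (hη : 0 < η) (hαf : 0 < αf) (hαg : 0 < αg)
    (hf : StrongConvexOn Set.univ αf f) (hg : StrongConvexOn Set.univ αg g)
    {F : EuclideanSpace ℝ (Fin n) × EuclideanSpace ℝ (Fin n) → ℝ} (hF : Measurable F) {M : ℝ}
    (hM : ∀ p, |F p| ≤ M) :
    ∫ p, F p ∂(targetXY n η f g) =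
      (∫ x, Real.exp (-f x) * ∫ y, F (x, y) * condDens η g x y) /
        ∫ x, Real.exp (-f x) * ∫ y, condDens η g x y := by
  have hN := integral_jointDens_pos hη hαf hαg hf hg
  have hm := measurable_jointDens (η := η) (hf.continuous_of_univ hαf) (hg.continuous_of_univ hαg)
  rw [targetXY, integral_withDensity_eq_integral_toReal_smul
    (hm.div_const _).ennreal_ofReal (ae_of_all _ fun _ => ENNReal.ofReal_lt_top),
    ← integral_mul_jointDens hη hαf hαg hf hg hF hM, ← integral_jointDens hη hαf hαg hf hg,
    ← integral_div]
  refine integral_congr_ae (ae_of_all _ fun p => ?_)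
  simp only [smul_eq_mul]
  rw [ENNReal.toReal_ofReal (div_nonneg (jointDens_pos p).le hN.le)]
  ring

lemma integral_targetX (hη : 0 < η) (hαf : 0 < αf) (hαg : 0 < αg)
    (hf : StrongConvexOn Set.univ αf f) (hg : StrongConvexOn Set.univ αg g)
    {w : EuclideanSpace ℝ (Fin n) → ℝ} (hw : Measurable w) {M : ℝ} (hM : ∀ x, |w x| ≤ M) :
    ∫ x, w x ∂(targetX n η f g) =
      (∫ x, w x * (Real.exp (-f x) * ∫ y, condDens η g x y)) /
        ∫ x, Real.exp (-f x) * ∫ y, condDens η g x y := by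
  rw [targetX, integral_map measurable_fst.aemeasurable hw.aestronglyMeasurable,
    integral_targetXY hη hαf hαg hf hg (F := fun p => w p.1) (hw.comp measurable_fst)
      fun p => hM p.1]
  simp only [integral_const_mul, mul_left_comm]

lemma integral_targetY (hη : 0 < η) (hαf : 0 < αf) (hαg : 0 < αg)
    (hf : StrongConvexOn Set.univ αf f) (hg : StrongConvexOn Set.univ αg g)
    {φ : EuclideanSpace ℝ (Fin n) → ℝ} (hφ : Measurable φ) {M : ℝ} (hM : ∀ y, |φ y| ≤ M) :
    ∫ y, φ y ∂(targetY n η f g) =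
      (∫ x, Real.exp (-f x) * ∫ y, φ y * condDens η g x y) /
        ∫ x, Real.exp (-f x) * ∫ y, condDens η g x y := by
  rw [targetY, integral_map measurable_snd.aemeasurable hφ.aestronglyMeasurable,
    integral_targetXY hη hαf hαg hf hg (F := fun p => φ p.2) (hφ.comp measurable_snd)
      fun p => hM p.2]

lemma volume_absolutelyContinuous_targetY (hη : 0 < η) (hαf : 0 < αf) (hαg : 0 < αg)
    (hf : StrongConvexOn Set.univ αf f) (hg : StrongConvexOn Set.univ αg g) :
    (volume : Measure (EuclideanSpace ℝ (Fin n))) ≪ targetY n η f g := by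
  have hN := integral_jointDens_pos hη hαf hαg hf hg
  have hm := measurable_jointDens (η := η) (hf.continuous_of_univ hαf) (hg.continuous_of_univ hαg)
  have hac : volume ≪ targetXY n η f g :=
    withDensity_absolutelyContinuous' (hm.div_const _).ennreal_ofReal.aemeasurable
      (ae_of_all _ fun p => (ENNReal.ofReal_pos.2 (div_pos (jointDens_pos p) hN)).ne')
  refine Measure.AbsolutelyContinuous.mk fun s hs h0 => ?_
  rw [targetY, Measure.map_apply measurable_snd hs] at h0
  have h1 := hac h0
  rw [← Set.univ_prod, Measure.volume_eq_prod, Measure.prod_prod, mul_eq_zero] at h1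
  exact h1.resolve_left (NeZero.ne _)

end Target

section Transition

variable {n : ℕ} {η α : ℝ} {g : EuclideanSpace ℝ (Fin n) → ℝ}
  {μ : Measure (EuclideanSpace ℝ (Fin n))}

lemma condYgivenX_eq (x y : EuclideanSpace ℝ (Fin n)) :
    condYgivenX n η g x y = condDens η g x y / ∫ y', condDens η g x y' := rfl

lemma condYgivenX_nonneg (x y : EuclideanSpace ℝ (Fin n)) : 0 ≤ condYgivenX n η g x y :=
  div_nonneg (Real.exp_pos _).le (integral_nonneg fun _ => (Real.exp_pos _).le)

lemma measurable_condYgivenX (hg : Continuous g) :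
    Measurable fun p : EuclideanSpace ℝ (Fin n) × EuclideanSpace ℝ (Fin n) =>
      condYgivenX n η g p.1 p.2 :=
  (continuous_condDens hg).measurable.div ((measurable_integral_condDens hg).comp measurable_fst)

lemma integrable_condYgivenX [IsFiniteMeasure μ] (hη : 0 < η) (hα : 0 < α)
    (hg : StrongConvexOn Set.univ α g) :
    Integrable (fun p : EuclideanSpace ℝ (Fin n) × EuclideanSpace ℝ (Fin n) =>
      condYgivenX n η g p.1 p.2) (μ.prod volume) := by
  rw [integrable_prod_iff
    (measurable_condYgivenX (hg.continuous_of_univ hα)).aestronglyMeasurable]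
  refine ⟨ae_of_all _ fun x => (integrable_condDens hη hα hg x).div_const
    (∫ y, condDens η g x y), ?_⟩
  refine (integrable_const (1 : ℝ)).congr (ae_of_all _ fun x => ?_)
  calc (1 : ℝ) = ∫ y, condYgivenX n η g x y := by
        simp only [condYgivenX_eq, integral_div]
        exact (div_self (integral_condDens_pos hη hα hg x).ne').symm
    _ = ∫ y, ‖condYgivenX n η g x y‖ := by
        simp only [Real.norm_of_nonneg (condYgivenX_nonneg (η := η) (g := g) x _)]

lemma measurable_integral_condYgivenX [SFinite μ] (hg : Continuous g) :
    Measurable fun y => ∫ x, condYgivenX n η g x y ∂μ :=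
  (StronglyMeasurable.integral_prod_left' (μ := μ)
    (measurable_condYgivenX (η := η) hg).stronglyMeasurable).measurable

/-- Integrals against the law obtained from `μ` by one transition `x ↦ π^{Y|X=x}`. -/
lemma integral_withDensity_condYgivenX [IsFiniteMeasure μ] (hη : 0 < η) (hα : 0 < α)
    (hg : StrongConvexOn Set.univ α g) {φ : EuclideanSpace ℝ (Fin n) → ℝ} (hφ : Measurable φ)
    {M : ℝ} (hM : ∀ y, |φ y| ≤ M) :
    ∫ y, φ y ∂(volume.withDensity fun y => ENNReal.ofReal (∫ x, condYgivenX n η g x y ∂μ)) =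
      ∫ x, condMean η g φ x ∂μ := by
  have hi : Integrable (fun p : EuclideanSpace ℝ (Fin n) × EuclideanSpace ℝ (Fin n) =>
      φ p.2 * condYgivenX n η g p.1 p.2) (μ.prod volume) :=
    (integrable_condYgivenX hη hα hg).bdd_mul (hφ.comp measurable_snd).aestronglyMeasurable
      (ae_of_all _ fun p => by simpa using hM p.2)
  rw [integral_withDensity_eq_integral_toReal_smul
    (measurable_integral_condYgivenX (hg.continuous_of_univ hα)).ennreal_ofReal
    (ae_of_all _ fun _ => ENNReal.ofReal_lt_top)]
  calc ∫ y, (ENNReal.ofReal (∫ x, condYgivenX n η g x y ∂μ)).toReal • φ y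
      = ∫ y, ∫ x, φ y * condYgivenX n η g x y ∂μ := by
        refine integral_congr_ae (ae_of_all _ fun y => ?_)
        simp only [smul_eq_mul]
        rw [ENNReal.toReal_ofReal (integral_nonneg fun x => condYgivenX_nonneg x y),
          integral_const_mul, mul_comm]
    _ = ∫ x, (∫ y, φ y * condYgivenX n η g x y) ∂μ := (integral_integral_swap hi).symm
    _ = ∫ x, condMean η g φ x ∂μ := by
        refine integral_congr_ae (ae_of_all _ fun x => ?_)
        simp only [condYgivenX_eq, condMean, ← mul_div_assoc, integral_div]

lemma isProbabilityMeasure_withDensity_condYgivenX [IsProbabilityMeasure μ] (hη : 0 < η)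
    (hα : 0 < α) (hg : StrongConvexOn Set.univ α g) :
    IsProbabilityMeasure
      (volume.withDensity fun y => ENNReal.ofReal (∫ x, condYgivenX n η g x y ∂μ)) := by
  have hi := integrable_condYgivenX (μ := μ) hη hα hg
  refine ⟨?_⟩
  rw [withDensity_apply _ MeasurableSet.univ, setLIntegral_univ,
    ← ofReal_integral_eq_lintegral_ofReal hi.integral_prod_right
      (ae_of_all _ fun y => integral_nonneg fun x => condYgivenX_nonneg x y),
    ← integral_integral_swap hi]
  simp only [condYgivenX_eq, integral_div,
    div_self (integral_condDens_pos (η := η) hη hα hg _).ne']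
  simp

end Transition

/-- one-step contraction of the two-node Gibbs sampler. -/
theorem one_step_contraction_two_node
    (hd : 1 ≤ d) (hη : 0 < η)
    (f g : EuclideanSpace ℝ (Fin d) → ℝ) (αf αg : ℝ) (hαf : 0 < αf) (hαg : 0 < αg)
    (hf : StrongConvexOn Set.univ αf f) (hg : StrongConvexOn Set.univ αg g)
    (μX : Measure (EuclideanSpace ℝ (Fin d))) [IsProbabilityMeasure μX]
    (hKLfin : klDiv μX (targetX d η f g) < ⊤)
    (μY : Measure (EuclideanSpace ℝ (Fin d)))
    (hμY : μY = volume.withDensity fun y =>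
      ENNReal.ofReal (∫ x, condYgivenX d η g x y ∂μX)) :
    klDiv μY (targetY d η f g) ≤
      klDiv μX (targetX d η f g) / ENNReal.ofReal ((1 + η * αf) * (1 + η * αg)) := by
  have hπ := isProbabilityMeasure_targetXY hη hαf hαg hf hg
  have hπX : IsProbabilityMeasure (targetX d η f g) :=
    Measure.isProbabilityMeasure_map measurable_fst.aemeasurable
  have hπY : IsProbabilityMeasure (targetY d η f g) :=
    Measure.isProbabilityMeasure_map measurable_snd.aemeasurable
  have hacX : μX ≪ targetX d η f g := by
    by_contra hac
    rw [klDiv, if_neg hac] at hKLfin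
    exact lt_irrefl _ hKLfin
  have hprobY : IsProbabilityMeasure μY :=
    hμY ▸ isProbabilityMeasure_withDensity_condYgivenX hη hαg hg
  have hacY : μY ≪ targetY d η f g := by
    rw [hμY]
    exact (withDensity_absolutelyContinuous _ _).trans
      (volume_absolutelyContinuous_targetY hη hαf hαg hf hg)
  obtain ⟨L, hL⟩ : ∃ L, L = (1 + η * αf) * (1 + η * αg) := ⟨_, rfl⟩
  have hL0 : 0 < L := hL ▸ by positivity
  have hKL : klDiv μX (targetX d η f g) / ENNReal.ofReal L =
      ENNReal.ofReal ((klDiv μX (targetX d η f g)).toReal / L) := by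
    rw [ENNReal.ofReal_div_of_pos hL0, ENNReal.ofReal_toReal hKLfin.ne]
  rw [← hL, hKL]
  refine klDiv_le_ofReal_of_forall_integral_le hacY fun φ hφ ⟨M, hM⟩ => ?_
  have hgc := hg.continuous_of_univ hαg
  have hu : Measurable fun x => L * condMean η g φ x := (measurable_condMean hgc hφ).const_mul L
  have huM : ∀ x, |L * condMean η g φ x| ≤ L * M := fun x => by
    rw [abs_mul, abs_of_pos hL0]
    exact mul_le_mul_of_nonneg_left (abs_condMean_le hη hαg hg hφ hM x) hL0.le
  have hdual := integral_exp_condMean_rpow_mul_le hη hαf hαg hf hg hφ hM hL rfl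
  have hDV := integral_le_toReal_klDiv_add_log hacX hKLfin hu huM
  have hexpX : 0 < ∫ x, Real.exp (L * condMean η g φ x) ∂(targetX d η f g) :=
    integral_exp_pos (integrable_of_abs_le hu.exp (abs_exp_le huM))
  rw [integral_const_mul] at hDV
  rw [integral_targetX hη hαf hαg hf hg hu.exp (abs_exp_le huM)] at hDV hexpX
  rw [hμY, integral_withDensity_condYgivenX hη hαg hg hφ hM,
    integral_targetY hη hαf hαg hf hg hφ.exp (abs_exp_le hM)]
  have hN := integral_jointDens_pos hη hαf hαg hf hg
  rw [integral_jointDens hη hαf hαg hf hg] at hN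
  set N := ∫ x, Real.exp (-f x) * ∫ y, condDens η g x y
  set A := ∫ x, Real.exp (L * condMean η g φ x) * (Real.exp (-f x) * ∫ y, condDens η g x y)
  set B := ∫ x, Real.exp (-f x) * ∫ y, Real.exp (φ y) * condDens η g x y
  have hA : 0 < A := (div_pos_iff_of_pos_right hN).1 hexpX
  have hlog := Real.log_le_log (by positivity) hdual
  rw [Real.log_mul (by positivity) (by positivity), Real.log_rpow hA, Real.log_rpow hN] at hlog
  have hB : 0 < B := lt_of_lt_of_le (by positivity) hdual
  rw [Real.log_div hA.ne' hN.ne'] at hDV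
  rw [Real.log_div hB.ne' hN.ne']
  have hcL : 1 / L * L = 1 := one_div_mul_cancel hL0.ne'
  have := mul_le_mul_of_nonneg_left hDV (one_div_pos.2 hL0).le
  rw [← mul_assoc, hcL] at this
  rw [div_eq_mul_one_div (klDiv μX (targetX d η f g)).toReal]
  linarith

end
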